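/- Let A_1, ..., A_n : ℝⁿ → M_m(ℝ) be smooth matrix-valued functions satisfying the flatness condition ∂_i A_j − ∂_j A_i + A_i A_j − A_j A_i = 0 for all i, j. Then there exists a smooth map a : ℝⁿ → GL(m, ℝ) such that A_i(x) = a(x)⁻¹ · ∂_i a(x) for all i and all x ∈ ℝⁿ. -/

import Mathlib

attribute [local instance] Matrix.linftyOpNormedRing Matrix.linftyOpNormedAlgebra

/-- Partial derivative in the `i`-th coordinate direction of a matrix-valued
function on `ℝⁿ`. -/
noncomputable def mpd {n m : ℕ} (i : Fin n)
    (f : (Fin n → ℝ) → Matrix (Fin m) (Fin m) ℝ) (x : Fin n → ℝ) :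
    Matrix (Fin m) (Fin m) ℝ :=
  fderiv ℝ f x (Pi.single i 1)

open Set Metric Filter Topology
open scoped NNReal ContDiff

section LinearODE

variable {F : Type*} [NormedAddCommGroup F] [NormedSpace ℝ F]

/-- Grönwall's inequality on `[0, 1]`. -/
theorem norm_le_gronwallBound_Icc {f f' : ℝ → F} {δ K ε : ℝ}
    (hf : ∀ t ∈ Icc (0 : ℝ) 1, HasDerivWithinAt f (f' t) (Icc 0 1) t) (h0 : ‖f 0‖ ≤ δ)
    (bound : ∀ t ∈ Icc (0 : ℝ) 1, ‖f' t‖ ≤ K * ‖f t‖ + ε) :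
    ∀ t ∈ Icc (0 : ℝ) 1, ‖f t‖ ≤ gronwallBound δ K ε t := by
  intro t ht
  simpa using norm_le_gronwallBound_of_norm_deriv_right_le
    (fun s hs => (hf s hs).continuousWithinAt)
    (fun s hs => (hf s (Ico_subset_Icc_self hs)).mono_of_mem_nhdsWithin
      (Icc_mem_nhdsGE_of_mem hs)) h0 (fun s hs => bound s (Ico_subset_Icc_self hs)) t ht

/-- The radial retraction onto the closed ball of radius `R` is `2`-Lipschitz. -/
theorem lipschitzWith_radial_retraction {R : ℝ} (hR : 0 < R) :
    LipschitzWith 2 (fun u : F => (R / max R ‖u‖) • u) := by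
  refine LipschitzWith.of_dist_le_mul fun u v => ?_
  have hp : 0 < max R ‖u‖ := lt_max_of_lt_left hR
  have hq : 0 < max R ‖v‖ := lt_max_of_lt_left hR
  have hp1 : R / max R ‖u‖ ≤ 1 := (div_le_one hp).2 (le_max_left _ _)
  have hp0 : 0 ≤ R / max R ‖u‖ := by positivity
  have hmax : |max R ‖v‖ - max R ‖u‖| ≤ ‖u - v‖ := by
    have h1 := abs_max_sub_max_le_abs ‖v‖ ‖u‖ R
    rw [max_comm _ R, max_comm _ R] at h1
    exact h1.trans (norm_sub_rev u v ▸ abs_norm_sub_norm_le v u)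
  have hdecomp : (R / max R ‖u‖) • u - (R / max R ‖v‖) • v
      = (R / max R ‖u‖) • (u - v) + (R / max R ‖u‖ - R / max R ‖v‖) • v := by
    module
  have hcoef : R / max R ‖u‖ - R / max R ‖v‖
      = R / max R ‖u‖ * ((max R ‖v‖ - max R ‖u‖) / max R ‖v‖) := by
    field_simp
  have hsecond : ‖(R / max R ‖u‖ - R / max R ‖v‖) • v‖ ≤ ‖u - v‖ := by
    rw [hcoef, norm_smul, norm_mul, Real.norm_of_nonneg hp0, norm_div, Real.norm_of_nonneg hq.le,
      Real.norm_eq_abs, mul_assoc, div_mul_eq_mul_div |max R ‖v‖ - max R ‖u‖|]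
    have h2 : |max R ‖v‖ - max R ‖u‖| * ‖v‖ / max R ‖v‖ ≤ ‖u - v‖ := by
      rw [div_le_iff₀ hq]
      exact mul_le_mul hmax (le_max_right _ _) (norm_nonneg _) (norm_nonneg _)
    calc _ ≤ 1 * (|max R ‖v‖ - max R ‖u‖| * ‖v‖ / max R ‖v‖) :=
          mul_le_mul_of_nonneg_right hp1 (by positivity)
      _ ≤ _ := by simpa using h2
  have hfirst : ‖(R / max R ‖u‖) • (u - v)‖ ≤ ‖u - v‖ := by
    rw [norm_smul, Real.norm_of_nonneg hp0]
    exact mul_le_of_le_one_left (norm_nonneg _) hp1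
  rw [dist_eq_norm, dist_eq_norm, hdecomp]
  refine (norm_add_le _ _).trans ?_
  simp only [NNReal.coe_ofNat]
  linarith

/-- Solutions of linear differential equations exist on all of `[0, 1]`. -/
theorem exists_linearODE_solution [CompleteSpace F] {L : ℝ → F →L[ℝ] F} (hL : Continuous L)
    (u₀ : F) :
    ∃ u : ℝ → F, u 0 = u₀ ∧
      ∀ t ∈ Icc (0 : ℝ) 1, HasDerivWithinAt u (L t (u t)) (Icc 0 1) t := by
  obtain ⟨M, hM⟩ := isCompact_Icc.exists_bound_of_continuousOn (s := Icc (0 : ℝ) 1) hL.continuousOn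
  have hM0 : 0 ≤ M := (norm_nonneg _).trans (hM 0 (by simp))
  set R : ℝ := gronwallBound ‖u₀‖ M 0 1 + 1 with hRdef
  have hb0 : ∀ t, gronwallBound ‖u₀‖ M 0 t = ‖u₀‖ * Real.exp (M * t) :=
    gronwallBound_ε0 _ _
  have hR : 0 < R := by rw [hRdef, hb0]; positivity
  set φ : F → F := fun u => (R / max R ‖u‖) • u with hφ
  have hφlip : LipschitzWith 2 φ := lipschitzWith_radial_retraction hR
  have hφnorm : ∀ u, ‖φ u‖ = R / max R ‖u‖ * ‖u‖ := fun u => by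
    rw [hφ, norm_smul, Real.norm_of_nonneg (by positivity)]
  have hφR : ∀ u, ‖φ u‖ ≤ R := fun u => by
    rw [hφnorm, div_mul_eq_mul_div, div_le_iff₀ (lt_max_of_lt_left hR)]
    gcongr
    exact le_max_right _ _
  have hφle : ∀ u, ‖φ u‖ ≤ ‖u‖ := fun u => by
    rw [hφnorm]
    exact mul_le_of_le_one_left (norm_nonneg _)
      ((div_le_one (lt_max_of_lt_left hR)).2 (le_max_left _ _))
  have hPL : IsPicardLindelof (fun t u => L t (φ u)) (⟨0, by simp⟩ : Icc (0 : ℝ) 1) u₀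
      (⟨M, hM0⟩ * ⟨R, hR.le⟩) 0 (⟨M, hM0⟩ * ⟨R, hR.le⟩) (⟨M, hM0⟩ * 2) := by
    refine ⟨fun t ht => ?_, fun u _ => by fun_prop, fun t ht u _ => ?_, by simp⟩
    · exact ((ContinuousLinearMap.lipschitzWith_of_opNorm_le (K := ⟨M, hM0⟩) (hM t ht)).comp
        hφlip).lipschitzOnWith
    · exact (L t).le_of_opNorm_le_of_le (hM t ht) (hφR u)
  obtain ⟨u, hu0, hu⟩ := hPL.exists_eq_forall_mem_Icc_hasDerivWithinAt₀
  refine ⟨u, hu0, fun t ht => ?_⟩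
  have hbound : ‖u t‖ ≤ R := by
    have h1 := norm_le_gronwallBound_Icc (δ := ‖u₀‖) (K := M) (ε := 0) hu
      (le_of_eq (congrArg norm hu0))
      (fun s hs => by simpa using (L s).le_of_opNorm_le_of_le (hM s hs) (hφle (u s))) t ht
    have h2 := gronwallBound_mono (norm_nonneg u₀) le_rfl hM0 ht.2
    linarith
  have hfix : φ (u t) = u t := by
    simp [hφ, max_eq_left hbound, hR.ne']
  simpa [hfix] using hu t ht

end LinearODE

/-- A jointly continuous function on `X × [0, 1]` is equicontinuous in the first variable. -/
theorem eventually_forall_Icc_norm_sub_le {X F : Type*} [TopologicalSpace X]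
    [NormedAddCommGroup F] {G : X → ℝ → F}
    (hG : Continuous (fun p : X × ℝ => G p.1 p.2)) (x : X) {ε : ℝ} (hε : 0 < ε) :
    ∀ᶠ y in 𝓝 x, ∀ t ∈ Icc (0 : ℝ) 1, ‖G y t - G x t‖ ≤ ε := by
  refine isCompact_Icc.eventually_forall_of_forall_eventually fun t _ => ?_
  have hc : Continuous (fun p : X × ℝ => ‖G p.1 p.2 - G x p.2‖) := by
    have : Continuous (fun p : X × ℝ => G x p.2) :=
      hG.comp (continuous_const.prodMk continuous_snd)
    fun_prop
  exact (hc.tendsto (x, t)).eventually_le_const (by simpa using hε)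

section FlatConnection

variable {E R : Type*} [NormedAddCommGroup E] [NormedSpace ℝ E] [NormedRing R] [NormedAlgebra ℝ R]

/-- The solution at time `1` of `U' = U B`, `U(0) = 1` has a right inverse. -/
theorem exists_mul_eq_one_of_linearODE [CompleteSpace R] {B U : ℝ → R} (hB : Continuous B)
    (hU0 : U 0 = 1)
    (hU : ∀ t ∈ Icc (0 : ℝ) 1, HasDerivWithinAt U (U t * B t) (Icc 0 1) t) :
    ∃ b, U 1 * b = 1 := by
  obtain ⟨W, hW0, hW⟩ := exists_linearODE_solution
    (L := fun t => ContinuousLinearMap.mul ℝ R (-B t)) (by fun_prop) (1 : R)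
  have hderiv : ∀ t ∈ Icc (0 : ℝ) 1,
      HasDerivWithinAt (fun t => U t * W t - 1) 0 (Icc 0 1) t := fun t ht => by
    refine (((hU t ht).mul (hW t ht)).sub_const 1).congr_deriv ?_
    simp [mul_assoc]
  have h := norm_le_gronwallBound_Icc (δ := 0) (K := 0) (ε := 0) hderiv
    (by simp [hU0, hW0]) (by simp) 1 (by simp)
  rw [gronwallBound_ε0_δ0, norm_le_zero_iff, sub_eq_zero] at h
  exact ⟨W 1, h⟩

/-- Radial transport along a flat connection `θ` has derivative `U θ`. -/
theorem hasFDerivAt_radial_transport {θ : E → E →L[ℝ] R} (hθ : ContDiff ℝ 1 θ)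
    (hflat : ∀ x h k, fderiv ℝ θ x h k - fderiv ℝ θ x k h + θ x h * θ x k - θ x k * θ x h = 0)
    {U : E → ℝ → R} (hU0 : ∀ x, U x 0 = 1)
    (hU : ∀ x, ∀ t ∈ Icc (0 : ℝ) 1,
      HasDerivWithinAt (U x) (U x t * θ (t • x) x) (Icc 0 1) t) (x : E) :
    HasFDerivAt (fun y => U y 1) (ContinuousLinearMap.mul ℝ R (U x 1) ∘L θ x) x := by
  have hθd : Differentiable ℝ θ := hθ.differentiable one_ne_zero
  have hθc : Continuous θ := hθ.continuous
  have hθ'c : Continuous (fderiv ℝ θ) := hθ.continuous_fderiv one_ne_zero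
  set B : E → ℝ → R := fun y t => θ (t • y) y with hB
  set dB : E → ℝ → E →L[ℝ] R := fun y t =>
    θ (t • y) + t • (fderiv ℝ θ (t • y)).flip y with hdB
  have hBd : ∀ y t, HasFDerivAt (fun z => B z t) (dB y t) y := fun y t => by
    have h1 : HasFDerivAt (fun z : E => t • z) (t • ContinuousLinearMap.id ℝ E) y :=
      (hasFDerivAt_id y).const_smul t
    refine (((hθd (t • y)).hasFDerivAt.comp y h1).clm_apply (hasFDerivAt_id y)).congr_fderiv ?_
    ext h
    simp [hdB]
  have hBc : Continuous (fun p : E × ℝ => B p.1 p.2) := by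
    simp only [hB]; fun_prop
  have hdBc : Continuous (fun p : E × ℝ => dB p.1 p.2) := by
    have hflip : Continuous (fun p : E × ℝ => (fderiv ℝ θ (p.2 • p.1)).flip) :=
      (ContinuousLinearMap.flipₗᵢ ℝ E E R).continuous.comp (by fun_prop)
    simp only [hdB]; fun_prop
  obtain ⟨M₁, hM₁⟩ := isCompact_Icc.exists_bound_of_continuousOn (s := Icc (0 : ℝ) 1)
    (f := U x) (fun t ht => (hU x t ht).continuousWithinAt)
  obtain ⟨M₂, hM₂⟩ := isCompact_Icc.exists_bound_of_continuousOn (s := Icc (0 : ℝ) 1)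
    (f := B x) (hBc.comp (by fun_prop : Continuous fun t : ℝ => (x, t))).continuousOn
  obtain ⟨M₃, hM₃⟩ := isCompact_Icc.exists_bound_of_continuousOn (s := Icc (0 : ℝ) 1)
    (f := dB x) (hdBc.comp (by fun_prop : Continuous fun t : ℝ => (x, t))).continuousOn
  obtain ⟨M₄, hM₄⟩ := isCompact_Icc.exists_bound_of_continuousOn (s := Icc (0 : ℝ) 1)
    (f := fun t : ℝ => θ (t • x)) (by fun_prop)
  have h01 : (0 : ℝ) ∈ Icc (0 : ℝ) 1 := by simp
  have hM₁0 : 0 ≤ M₁ := (norm_nonneg _).trans (hM₁ 0 h01)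
  have hM₂0 : 0 ≤ M₂ := (norm_nonneg _).trans (hM₂ 0 h01)
  have hM₃0 : 0 ≤ M₃ := (norm_nonneg _).trans (hM₃ 0 h01)
  have hM₄0 : 0 ≤ M₄ := (norm_nonneg _).trans (hM₄ 0 h01)
  set K := M₂ + 1 with hK
  have hK0 : 0 < K := by positivity
  set C₁ := M₁ + M₁ * M₄ + M₁ * M₄ * M₃ with hC₁
  have hC₁0 : 0 ≤ C₁ := by positivity
  set C := C₁ / K * (Real.exp K - 1) with hC
  have hC0 : 0 ≤ C := by
    have : 0 ≤ Real.exp K - 1 := by linarith [Real.one_le_exp hK0.le]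
    positivity
  rw [hasFDerivAt_iff_isLittleO, Asymptotics.isLittleO_iff]
  intro c hc
  set ε := c / (C + 1) with hε
  have hε0 : 0 < ε := by positivity
  have hCε : C * ε ≤ c := by
    rw [hε, mul_div_assoc', div_le_iff₀ (by positivity)]; nlinarith
  obtain ⟨r, hr0, hr⟩ := Metric.eventually_nhds_iff_ball.1
    (eventually_forall_Icc_norm_sub_le hdBc x hε0)
  filter_upwards [Metric.ball_mem_nhds x hr0, Metric.ball_mem_nhds x hε0,
    Metric.ball_mem_nhds x one_pos, eventually_forall_Icc_norm_sub_le hBc x one_pos]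
    with y hyr hyε hy1 hyB
  set h := y - x with hh
  have hhε : ‖h‖ ≤ ε := (mem_ball_iff_norm.1 hyε).le
  have hh1 : ‖h‖ ≤ 1 := (mem_ball_iff_norm.1 hy1).le
  set V : ℝ → R := fun t => U x t * (1 + t • θ (t • x) h) with hV
  -- `V` solves the equation of `U y` up to an error of order `o(‖h‖)`
  have hVd : ∀ t ∈ Icc (0 : ℝ) 1,
      HasDerivWithinAt V (V t * B x t + U x t * dB x t h) (Icc 0 1) t := fun t ht => by
    have h1 : HasDerivAt (fun s : ℝ => s • x) x t := by
      simpa using (hasDerivAt_id t).smul_const x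
    have h2 : HasDerivAt (fun s : ℝ => θ (s • x)) (fderiv ℝ θ (t • x) x) t :=
      (hθd (t • x)).hasFDerivAt.comp_hasDerivAt t h1
    have h3 : HasDerivAt (fun s : ℝ => θ (s • x) h) (fderiv ℝ θ (t • x) x h) t := by
      simpa using h2.clm_apply (hasDerivAt_const t h)
    have h4 := ((hasDerivAt_id t).smul h3).const_add 1
    have h5 : fderiv ℝ θ (t • x) x h = fderiv ℝ θ (t • x) h x
        + θ (t • x) h * θ (t • x) x - θ (t • x) x * θ (t • x) h := by
      have := hflat (t • x) h x
      rw [← sub_eq_zero, ← neg_eq_zero, ← this]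
      abel
    refine ((hU x t ht).mul h4.hasDerivWithinAt).congr_deriv ?_
    simp only [hV, hB, hdB, id, h5, Pi.smul_apply', add_apply, smul_apply,
      ContinuousLinearMap.flip_apply, smul_add, smul_sub, mul_add, add_mul, mul_sub, one_smul,
      mul_one, mul_smul_comm, smul_mul_assoc, mul_assoc]
    abel
  have herr : ∀ t ∈ Icc (0 : ℝ) 1, ‖B y t - B x t - dB x t h‖ ≤ ε * ‖h‖ := fun t ht =>
    (convex_ball x r).norm_image_sub_le_of_norm_hasFDerivWithin_le'
      (fun z _ => (hBd z t).hasFDerivWithinAt) (fun z hz => hr z hz t ht)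
      (mem_ball_self hr0) hyr
  have hDd : ∀ t ∈ Icc (0 : ℝ) 1, HasDerivWithinAt (fun t => U y t - V t)
      ((U y t - V t) * B y t + (V t * (B y t - B x t - dB x t h)
        + U x t * (t • θ (t • x) h) * dB x t h)) (Icc 0 1) t := fun t ht => by
    refine ((hU y t ht).sub (hVd t ht)).congr_deriv ?_
    simp only [hV, hB, mul_add, add_mul, mul_sub, sub_mul, mul_one]
    abel
  have hDbound : ∀ t ∈ Icc (0 : ℝ) 1, ‖(U y t - V t) * B y t + (V t * (B y t - B x t - dB x t h)
      + U x t * (t • θ (t • x) h) * dB x t h)‖ ≤ K * ‖U y t - V t‖ + C₁ * ε * ‖h‖ :=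
      fun t ht => by
    have hBy : ‖B y t‖ ≤ K := by
      have := norm_le_norm_add_norm_sub' (B y t) (B x t)
      linarith [hM₂ t ht, hyB t ht]
    have ht1 : ‖t‖ ≤ 1 := by rw [Real.norm_of_nonneg ht.1]; exact ht.2
    have hθh : ‖t • θ (t • x) h‖ ≤ M₄ * ‖h‖ := by
      rw [norm_smul]
      exact (mul_le_of_le_one_left (norm_nonneg _) ht1).trans
        ((θ (t • x)).le_of_opNorm_le (hM₄ t ht) h)
    have hUθ : ‖U x t * (t • θ (t • x) h)‖ ≤ M₁ * (M₄ * ‖h‖) :=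
      norm_mul_le_of_le (hM₁ t ht) hθh
    have hVn : ‖V t‖ ≤ M₁ + M₁ * M₄ := by
      have : V t = U x t + U x t * (t • θ (t • x) h) := by simp only [hV, mul_add, mul_one]
      rw [this]
      refine norm_add_le_of_le (hM₁ t ht) (hUθ.trans ?_)
      gcongr
      exact mul_le_of_le_one_right hM₄0 hh1
    have hdBh : ‖dB x t h‖ ≤ M₃ * ε :=
      (dB x t).le_of_opNorm_le_of_le (hM₃ t ht) hhε
    have e1 : ‖(U y t - V t) * B y t‖ ≤ ‖U y t - V t‖ * K := norm_mul_le_of_le le_rfl hBy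
    have e2 := norm_mul_le_of_le hVn (herr t ht)
    have e3 := norm_mul_le_of_le hUθ hdBh
    refine (norm_add_le_of_le e1 (norm_add_le_of_le e2 e3)).trans (le_of_eq ?_)
    rw [hC₁]; ring
  have key := norm_le_gronwallBound_Icc (δ := 0) hDd (by simp [hV, hU0]) hDbound 1 (by simp)
  rw [gronwallBound_of_K_ne_0 hK0.ne'] at key
  have hgoal : U y 1 - U x 1 - (ContinuousLinearMap.mul ℝ R (U x 1) ∘L θ x) h = U y 1 - V 1 := by
    simp [hV, mul_add, sub_sub]
  rw [hgoal]
  calc _ ≤ _ := key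
    _ = C * ε * ‖h‖ := by rw [hC]; simp; ring
    _ ≤ c * ‖h‖ := by gcongr

/-- A function whose derivative is `a θ` is as smooth as `θ`. -/
theorem contDiff_of_hasFDerivAt_mul {θ : E → E →L[ℝ] R} (hθ : ContDiff ℝ ∞ θ) {a : E → R}
    (ha : ∀ x, HasFDerivAt a (ContinuousLinearMap.mul ℝ R (a x) ∘L θ x) x) :
    ContDiff ℝ ∞ a := by
  refine contDiff_infty.2 fun n => ?_
  induction n with
  | zero =>
    exact contDiff_zero.2 (continuous_iff_continuousAt.2 fun x => (ha x).continuousAt)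
  | succ n ih =>
    refine contDiff_succ_iff_hasFDerivAt.2 ⟨_, ?_, ha⟩
    exact ((ContinuousLinearMap.mul ℝ R).contDiff.comp ih).clm_comp
      (hθ.of_le (by exact_mod_cast le_top))

/-- A smooth flat connection form on a normed space with values in a Banach algebra is pure
gauge: `da = a θ` with `a` smooth and right-invertible. -/
theorem exists_gauge_of_flat [CompleteSpace R] {θ : E → E →L[ℝ] R} (hθ : ContDiff ℝ ∞ θ)
    (hflat : ∀ x h k, fderiv ℝ θ x h k - fderiv ℝ θ x k h + θ x h * θ x k - θ x k * θ x h = 0) :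
    ∃ a : E → R, ContDiff ℝ ∞ a ∧ (∀ x, ∃ b, a x * b = 1) ∧
      ∀ x, HasFDerivAt a (ContinuousLinearMap.mul ℝ R (a x) ∘L θ x) x := by
  have hθc : Continuous θ := hθ.continuous
  have hex : ∀ x, ∃ u : ℝ → R, u 0 = 1 ∧
      ∀ t ∈ Icc (0 : ℝ) 1, HasDerivWithinAt u (u t * θ (t • x) x) (Icc 0 1) t := fun x => by
    simpa using exists_linearODE_solution
      (L := fun t => (ContinuousLinearMap.mul ℝ R).flip (θ (t • x) x)) (by fun_prop) (1 : R)
  choose U hU0 hU using hex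
  have hd := hasFDerivAt_radial_transport (hθ.of_le (by exact_mod_cast le_top)) hflat hU0 hU
  exact ⟨fun x => U x 1, contDiff_of_hasFDerivAt_mul hθ hd,
    fun x => exists_mul_eq_one_of_linearODE (by fun_prop) (hU0 x) (hU x), hd⟩

/-- In coordinates: every smooth flat family `A₁, …, Aₙ` on `ℝⁿ` with values in a Banach algebra
satisfies `∂ᵢa = a Aᵢ` for some smooth right-invertible `a`. -/
theorem exists_gauge_of_flat_coordinates [CompleteSpace R] {n : ℕ} {A : Fin n → (Fin n → ℝ) → R}
    (hA : ∀ i, ContDiff ℝ ∞ (A i))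
    (hflat : ∀ (i j : Fin n) (x : Fin n → ℝ),
      fderiv ℝ (A j) x (Pi.single i 1) - fderiv ℝ (A i) x (Pi.single j 1)
        + A i x * A j x - A j x * A i x = 0) :
    ∃ a : (Fin n → ℝ) → R, ContDiff ℝ ∞ a ∧ (∀ x, ∃ b, a x * b = 1) ∧
      ∀ (i : Fin n) (x : Fin n → ℝ), fderiv ℝ a x (Pi.single i 1) = a x * A i x := by
  set θ : (Fin n → ℝ) → (Fin n → ℝ) →L[ℝ] R := fun x =>
    ∑ i, (ContinuousLinearMap.proj i : (Fin n → ℝ) →L[ℝ] ℝ).smulRight (A i x) with hθdef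
  have hθapply : ∀ x h, θ x h = ∑ i, h i • A i x := fun x h => by simp [hθdef]
  have hθ : ContDiff ℝ ∞ θ := ContDiff.sum fun i _ =>
    ((ContinuousLinearMap.smulRightL ℝ (Fin n → ℝ) R)
      (ContinuousLinearMap.proj i)).contDiff.comp (hA i)
  have hAd : ∀ i, Differentiable ℝ (A i) := fun i => (hA i).differentiable (by simp)
  have hfderiv : ∀ x h k, fderiv ℝ θ x h k = ∑ i, ∑ j,
      (h i * k j) • fderiv ℝ (A j) x (Pi.single i 1) := by
    intro x h k
    have h1 : HasFDerivAt (fun y => θ y k) (∑ j, k j • fderiv ℝ (A j) x) x := by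
      simp only [hθapply]
      exact HasFDerivAt.fun_sum fun j _ => (hAd j x).hasFDerivAt.const_smul (k j)
    have h2 : HasFDerivAt (fun y => θ y k) ((fderiv ℝ θ x).flip k) x := by
      refine ((hθ.differentiable (by simp) x).hasFDerivAt.clm_apply
        (hasFDerivAt_const k x)).congr_fderiv ?_
      ext h
      simp
    have h3 := congrArg (fun T => T h) (h2.unique h1)
    have h4 : ∀ j, fderiv ℝ (A j) x h = ∑ i, h i • fderiv ℝ (A j) x (Pi.single i 1) := fun j => by
      conv_lhs => rw [pi_eq_sum_univ' h]
      simp only [map_sum, map_smul]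
    simp only [ContinuousLinearMap.flip_apply, sum_apply,
      smul_apply, h4, Finset.smul_sum, smul_smul] at h3
    rw [h3, Finset.sum_comm]
    simp only [mul_comm]
  have hflatθ : ∀ x h k,
      fderiv ℝ θ x h k - fderiv ℝ θ x k h + θ x h * θ x k - θ x k * θ x h = 0 := by
    intro x h k
    have hmul : ∀ h k, θ x h * θ x k = ∑ i, ∑ j, (h i * k j) • (A i x * A j x) := fun h k => by
      simp only [hθapply, Finset.sum_mul_sum, smul_mul_smul_comm]
    rw [hfderiv x h k, hfderiv x k h, hmul h k, hmul k h,
      Finset.sum_comm (f := fun i j => (k i * h j) • fderiv ℝ (A j) x (Pi.single i 1)),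
      Finset.sum_comm (f := fun i j => (k i * h j) • (A i x * A j x))]
    simp only [← Finset.sum_sub_distrib, ← Finset.sum_add_distrib]
    refine Finset.sum_eq_zero fun i _ => Finset.sum_eq_zero fun j _ => ?_
    rw [mul_comm (k j), ← smul_sub, ← smul_add, ← smul_sub, hflat, smul_zero]
  obtain ⟨a, ha, hinv, hda⟩ := exists_gauge_of_flat hθ hflatθ
  refine ⟨a, ha, hinv, fun i x => ?_⟩
  rw [(hda x).fderiv]
  simp [hθapply, Pi.single_apply]

end FlatConnection

/-- Converse of the pulled-back Maurer–Cartan equations on the simply connected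
space `ℝⁿ`: every smooth flat family of matrix-valued `1`-form components
`A₁, …, Aₙ` (with `∂ᵢAⱼ − ∂ⱼAᵢ + [Aᵢ, Aⱼ] = 0`) is of the form `Aᵢ = a⁻¹ ∂ᵢa`
for a smooth map `a : ℝⁿ → GL(m, ℝ)`. -/
theorem maurer_cartan_flat_implies_gauge
    {n m : ℕ} (A : Fin n → (Fin n → ℝ) → Matrix (Fin m) (Fin m) ℝ)
    (hA : ∀ i, ContDiff ℝ (⊤ : ℕ∞) (A i))
    (hflat : ∀ (i j : Fin n) (x : Fin n → ℝ),
      mpd i (A j) x - mpd j (A i) x + A i x * A j x - A j x * A i x = 0) :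
    ∃ a : (Fin n → ℝ) → Matrix (Fin m) (Fin m) ℝ,
      ContDiff ℝ (⊤ : ℕ∞) a ∧ (∀ x, IsUnit (a x)) ∧
      ∀ (i : Fin n) (x : Fin n → ℝ), A i x = (a x)⁻¹ * mpd i a x := by
  obtain ⟨a, ha, hinv, hda⟩ := exists_gauge_of_flat_coordinates hA hflat
  have hunit : ∀ x, IsUnit (a x) := fun x =>
    (hinv x).elim fun b hb => IsUnit.of_mul_eq_one b hb
  refine ⟨a, ha, hunit, fun i x => ?_⟩
  have hdi : mpd i a x = a x * A i x := hda i x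
  rw [hdi, ← mul_assoc, Matrix.nonsing_inv_mul _ ((Matrix.isUnit_iff_isUnit_det _).1 (hunit x)),
    one_mul]
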